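/- arXiv:0708.0234 — 5 statements merged into one kernel-verified Lean document; each statement's English description precedes it below -/
import Mathlib

section
/- Let n, p ∈ ℕ. For i = 1,…,p let E^i be real antisymmetric n×n matrices that are linearly independent, let β = (β_{ik}) be a real symmetric invertible p×p matrix, and set D_i := −Σ_k β_{ik} E^k (so D^a_{ib} = −Σ_k β_{ik} E^k_{ab}). Assume there are real constants F^j_{ik} such that [D_i, D_k] = Σ_j F^j_{ik} D_j and that Σ_c (E^i_{ac} D^c_{kb} − E^i_{bc} D^c_{ka}) = Σ_j F^i_{kj} E^j_{ab} for all i,k,a,b. Then the matrix β satisfies Σ_k (β_{ik} F^k_{jl} + β_{lk} F^k_{ji}) = 0 for all i, j, l. -/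
open Matrix

/-- For linearly independent antisymmetric matrices `E^i`, a symmetric invertible
matrix `β`, `D_i = -β_{ik}E^k` satisfying `[D_i,D_k] = F^j_{ik}D_j` and the integrability
constraint, the matrix `β` satisfies `β_{ik}F^k_{jl} + β_{lk}F^k_{ji} = 0`. -/
theorem beta_F_invariance
    (n p : ℕ)
    (E : Fin p → Matrix (Fin n) (Fin n) ℝ)
    (hE : ∀ i, (E i)ᵀ = -(E i))
    (hEind : LinearIndependent ℝ E)
    (β : Matrix (Fin p) (Fin p) ℝ)
    (hβsymm : βᵀ = β) (hβinv : IsUnit β)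
    (D : Fin p → Matrix (Fin n) (Fin n) ℝ)
    (hD : ∀ i, D i = -∑ k, β i k • E k)
    (F : Fin p → Fin p → Fin p → ℝ)
    (hDD : ∀ i k, D i * D k - D k * D i = ∑ j, F j i k • D j)
    (hED : ∀ i k a b, (∑ c, (E i a c * D k c b - E i b c * D k c a))
        = ∑ j, F i k j * E j a b) :
    ∀ i j l, ∑ k, (β i k * F k j l + β l k * F k j i) = 0 := by
  have hDt : ∀ k, (D k)ᵀ = -(D k) := by
    intro k
    simp [hD, Matrix.transpose_sum, hE]
  have hcomm : ∀ i k, E i * D k - D k * E i = ∑ j, F i k j • E j := by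
    intro i k
    ext a b
    have hT : (E i * D k) b a = (D k * E i) a b := by
      rw [← Matrix.transpose_apply (E i * D k), Matrix.transpose_mul, hE, hDt, neg_mul_neg]
    rw [Matrix.sub_apply, ← hT, Matrix.mul_apply, Matrix.mul_apply, ← Finset.sum_sub_distrib,
      hED, Matrix.sum_apply]
    simp
  intro i j l
  have hfirst : ∑ m, (∑ k, β i k * F k j m) • E m = -(D i * D j - D j * D i) := by
    calc ∑ m, (∑ k, β i k * F k j m) • E m
        = ∑ k, β i k • ∑ m, F k j m • E m := by
          simp only [Finset.sum_smul, Finset.smul_sum, mul_smul]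
          exact Finset.sum_comm
      _ = (∑ k, β i k • E k) * D j - D j * ∑ k, β i k • E k := by
          simp only [← hcomm, smul_sub, Finset.sum_sub_distrib, Finset.sum_mul, Finset.mul_sum,
            Matrix.smul_mul, Matrix.mul_smul]
      _ = -(D i * D j - D j * D i) := by
          rw [hD i]
          noncomm_ring
  have hsecond : ∑ m, (∑ k, β m k * F k j i) • E m = -(D j * D i - D i * D j) := by
    have hsymm : ∀ m k, β m k = β k m := fun m k => congrFun (congrFun hβsymm.symm m) k
    rw [hDD]
    calc ∑ m, (∑ k, β m k * F k j i) • E m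
        = ∑ k, F k j i • ∑ m, β k m • E m := by
          simp only [Finset.sum_smul, Finset.smul_sum, smul_smul]
          rw [Finset.sum_comm]
          refine Finset.sum_congr rfl fun k _ => Finset.sum_congr rfl fun m _ => ?_
          rw [hsymm m k, mul_comm]
      _ = -∑ k, F k j i • D k := by simp [hD]
  refine Fintype.linearIndependent_iff.mp hEind
    (fun m => ∑ k, (β i k * F k j m + β m k * F k j i)) ?_ l
  simp only [Finset.sum_add_distrib, add_smul]
  rw [hfirst, hsecond]
  abel
end

section
/- Let n, p ∈ ℕ. For i = 1,…,p let E^i be real antisymmetric n×n matrices, let β = (β_{ik}) be a real symmetric invertible p×p matrix, and set D_i := −Σ_k β_{ik} E^k (so D^a_{ib} = −Σ_k β_{ik} E^k_{ab}). Let F^j_{ik} be real constants with Σ_c (E^i_{ac} D^c_{kb} − E^i_{bc} D^c_{ka}) = Σ_j F^i_{kj} E^j_{ab} and Σ_k (β_{ik} F^k_{jl} + β_{lk} F^k_{ji}) = 0. Set N := n + p, define constants C^A_{BC} (A = (a,i)) by C^i_{ab} = E^i_{ab}, C^a_{ib} = −C^a_{bi} = D^a_{ib}, C^i_{kl} = F^i_{kl},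 all other components zero, and define the symmetric invertible N×N matrix γ = (γ_{AB}) as the block-diagonal matrix with blocks δ_{ab} and β_{ik}. Then γ_{AB} C^B_{CD} + γ_{DB} C^B_{CA} = 0 for all A, C, D. -/
open Matrix

/-- The block-diagonal matrix `γ = diag(δ_{ab}, β_{ik})` satisfies the invariance
condition `γ_{AB} C^B_{CD} + γ_{DB} C^B_{CA} = 0` for the structure constants of the
curvature algebra. -/
theorem gamma_invariance
    (n p : ℕ)
    (E : Fin p → Matrix (Fin n) (Fin n) ℝ)
    (hE : ∀ i, (E i)ᵀ = -(E i))
    (β : Matrix (Fin p) (Fin p) ℝ)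
    (hβsymm : βᵀ = β) (hβinv : IsUnit β)
    (D : Fin p → Matrix (Fin n) (Fin n) ℝ)
    (hD : ∀ i, D i = -∑ k, β i k • E k)
    (F : Fin p → Fin p → Fin p → ℝ)
    (hED : ∀ i k a b, (∑ c, (E i a c * D k c b - E i b c * D k c a))
        = ∑ j, F i k j * E j a b)
    (hβF : ∀ i j l, ∑ k, (β i k * F k j l + β l k * F k j i) = 0)
    -- the structure constants C^A_{BC} of the curvature algebra
    (C : (Fin n ⊕ Fin p) → (Fin n ⊕ Fin p) → (Fin n ⊕ Fin p) → ℝ)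
    (hCiab : ∀ i a b, C (.inr i) (.inl a) (.inl b) = E i a b)
    (hCaib : ∀ a i b, C (.inl a) (.inr i) (.inl b) = D i a b)
    (hCabi : ∀ a b i, C (.inl a) (.inl b) (.inr i) = -D i a b)
    (hCikl : ∀ i k l, C (.inr i) (.inr k) (.inr l) = F i k l)
    (hCabc : ∀ a b c, C (.inl a) (.inl b) (.inl c) = 0)
    (hCikb : ∀ i k b, C (.inr i) (.inr k) (.inl b) = 0)
    (hCiak : ∀ i a k, C (.inr i) (.inl a) (.inr k) = 0)
    (hCaik : ∀ a i k, C (.inl a) (.inr i) (.inr k) = 0)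
    -- the block-diagonal matrix γ = diag(1, β)
    (γ : Matrix (Fin n ⊕ Fin p) (Fin n ⊕ Fin p) ℝ)
    (hγ : γ = Matrix.fromBlocks 1 0 0 β) :
    ∀ A C' D', ∑ B, (γ A B * C B C' D' + γ D' B * C B C' A) = 0 := by
  have hEanti : ∀ i a b, E i a b = -E i b a := fun i a b => by
    simpa using congrFun (congrFun (hE i) b) a
  have hDapp : ∀ i a b, D i a b = -∑ k, β i k * E k a b := fun i a b => by
    simp [hD, Matrix.sum_apply]
  have hDsum : ∀ i a b, ∑ k, β i k * E k b a = D i a b := fun i a b => by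
    simp [hDapp, hEanti _ b a]
  have hDanti : ∀ i a b, D i a b = -D i b a := fun i a b => by
    rw [← hDsum, hDapp, neg_neg]
  subst hγ
  rintro (a | i) (c | j) (d | l) <;>
    simp only [Finset.sum_add_distrib, Fintype.sum_sum_type, fromBlocks_apply₁₁,
      fromBlocks_apply₁₂, fromBlocks_apply₂₁, fromBlocks_apply₂₂,
      Matrix.zero_apply, Matrix.one_apply,
      ite_mul, one_mul, zero_mul, mul_zero, Finset.sum_ite_eq, Finset.mem_univ, if_true,
      Finset.sum_const_zero, add_zero, zero_add, neg_add_cancel, add_neg_cancel,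
      hCiab, hCaib, hCabi, hCikl, hCabc, hCikb,
      hCiak, hCaik, hDsum]
  · linarith [hDanti j a d]
  · simpa only [Finset.sum_add_distrib] using hβF i j l
end

section
/- Let D be a real n×n matrix with trace zero. Then det(Σ_{j≥0} (−1)^j D^j/(j+1)!) = det(Σ_{j≥0} (D/2)^{2j}/(2j+1)!); that is, the determinant of the matrix (1 − exp(−D))/D equals the determinant of the matrix sinh(D/2)/(D/2), both defined by their everywhere-convergent power series. -/
open Matrix

namespace PowerSeries

/-- The identity `e^{-X/2} · sinh(X/2)/(X/2) = (1 - e^{-X})/X` of formal power series. -/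
theorem rescale_exp_mul_sinhc :
    rescale (-1 / 2 : ℝ) (exp ℝ) *
        mk (fun m ↦ if Even m then (1 / 2 : ℝ) ^ m / (m + 1).factorial else 0)
      = mk (fun m ↦ (-1 : ℝ) ^ m / (m + 1).factorial) := by
  have hF : X * mk (fun m ↦ (-1 : ℝ) ^ m / (m + 1).factorial) = 1 - rescale (-1 : ℝ) (exp ℝ) := by
    ext m
    rcases m with _ | m
    · simp [-coeff_zero_eq_constantCoeff, coeff_zero_X_mul, coeff_rescale, coeff_exp]
    · rw [coeff_succ_X_mul]
      simp [coeff_one, coeff_exp, pow_succ, div_eq_mul_inv]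
  have hS : X * mk (fun m ↦ if Even m then (1 / 2 : ℝ) ^ m / (m + 1).factorial else 0)
      = rescale (1 / 2 : ℝ) (exp ℝ) - rescale (-1 / 2 : ℝ) (exp ℝ) := by
    ext m
    rcases m with _ | m
    · simp [-coeff_zero_eq_constantCoeff, coeff_zero_X_mul, coeff_rescale, coeff_exp]
    · rw [coeff_succ_X_mul]
      simp only [coeff_mk, map_sub, coeff_rescale, coeff_exp, neg_div]
      rcases Nat.even_or_odd m with h | h
      · rw [if_pos h, h.add_one.neg_pow]
        simp; ring
      · rw [if_neg (Nat.not_even_iff_odd.2 h), h.add_one.neg_pow]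
        simp
  apply mul_left_cancel₀ (X_ne_zero (R := ℝ))
  rw [hF, mul_left_comm, hS, mul_sub, exp_mul_exp_eq_exp_add, exp_mul_exp_eq_exp_add]
  norm_num [rescale_zero]

end PowerSeries

section

variable {𝔸 : Type*} [NormedRing 𝔸] [NormedAlgebra ℝ 𝔸]

/-- A power series whose coefficients are dominated by those of the exponential converges
absolutely everywhere. -/
theorem summable_norm_smul_pow_of_abs_le_inv_factorial {c : ℕ → ℝ}
    (hc : ∀ m, |c m| ≤ (m.factorial : ℝ)⁻¹) (x : 𝔸) : Summable fun m ↦ ‖c m • x ^ m‖ := by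
  refine (NormedSpace.norm_expSeries_summable' (𝕂 := ℝ) x).of_nonneg_of_le
    (fun _ ↦ norm_nonneg _) fun m ↦ ?_
  rw [norm_smul, norm_smul, Real.norm_eq_abs, Real.norm_of_nonneg (by positivity)]
  gcongr
  exact hc m

theorem abs_pow_div_factorial_succ_le {r : ℝ} (hr : |r| ≤ 1) (m : ℕ) :
    |r ^ m / (m + 1).factorial| ≤ (m.factorial : ℝ)⁻¹ := by
  rw [abs_div, abs_pow, Nat.abs_cast, div_eq_mul_inv]
  refine (mul_le_of_le_one_left (by positivity) (pow_le_one₀ (abs_nonneg r) hr)).trans ?_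
  gcongr
  omega

theorem tsum_one_sub_exp_neg_eq_exp_mul_tsum_sinhc [CompleteSpace 𝔸] (x : 𝔸) :
    ∑' j : ℕ, ((-1 : ℝ) ^ j / (Nat.factorial (j + 1))) • x ^ j
      = NormedSpace.exp ((-1 / 2 : ℝ) • x) *
        ∑' j : ℕ, ((1 : ℝ) / (Nat.factorial (2 * j + 1))) • ((1/2 : ℝ) • x) ^ (2 * j) := by
  have hS : ∑' j : ℕ, ((1 : ℝ) / (Nat.factorial (2 * j + 1))) • ((1/2 : ℝ) • x) ^ (2 * j)
      = ∑' m : ℕ, (if Even m then (1 / 2 : ℝ) ^ m / (m + 1).factorial else 0) • x ^ m := by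
    have hinj : Function.Injective fun j : ℕ ↦ 2 * j := fun a b h ↦ by simpa using h
    rw [← hinj.tsum_eq (f := fun m : ℕ ↦
      (if Even m then (1 / 2 : ℝ) ^ m / (m + 1).factorial else 0) • x ^ m)]
    · refine tsum_congr fun j ↦ ?_
      simp only [if_pos (even_two_mul j), smul_pow, smul_smul]
      ring_nf
    · intro m hm
      by_contra h
      refine hm ?_
      have : ¬ Even m := fun ⟨k, hk⟩ ↦ h ⟨k, by simp only; omega⟩
      simp [this]
  have hE : NormedSpace.exp ((-1 / 2 : ℝ) • x)
      = ∑' m : ℕ, ((-1 / 2 : ℝ) ^ m / m.factorial) • x ^ m := by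
    rw [NormedSpace.exp_eq_tsum ℝ]
    refine tsum_congr fun m ↦ ?_
    rw [smul_pow, smul_smul]
    ring_nf
  rw [hS, hE, tsum_mul_tsum_eq_tsum_sum_antidiagonal_of_summable_norm]
  · refine tsum_congr fun m ↦ ?_
    have h := congrArg (PowerSeries.coeff m) PowerSeries.rescale_exp_mul_sinhc
    rw [PowerSeries.coeff_mul, PowerSeries.coeff_mk] at h
    rw [← h, Finset.sum_smul]
    refine Finset.sum_congr rfl fun p hp ↦ ?_
    rw [smul_mul_smul_comm, ← pow_add, Finset.HasAntidiagonal.mem_antidiagonal.1 hp]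
    simp [PowerSeries.coeff_exp, div_eq_mul_inv]
  · refine summable_norm_smul_pow_of_abs_le_inv_factorial (fun m ↦ ?_) x
    rw [abs_div, abs_pow, Nat.abs_cast, div_eq_mul_inv]
    exact mul_le_of_le_one_left (by positivity) (pow_le_one₀ (abs_nonneg _) (by norm_num [abs_div]))
  · refine summable_norm_smul_pow_of_abs_le_inv_factorial (fun m ↦ ?_) x
    split_ifs
    · exact abs_pow_div_factorial_succ_le (by norm_num [abs_div]) m
    · simp

end

namespace Matrix

variable {ι : Type*} [Fintype ι] [DecidableEq ι]

/-- The derivative of the determinant at the identity matrix is the trace. -/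
theorem hasDerivAt_det_of_eq_one {M : ℝ → Matrix ι ι ℝ} {M' : Matrix ι ι ℝ} {t : ℝ}
    (hM : ∀ i j, HasDerivAt (fun s ↦ M s i j) (M' i j) t) (h1 : M t = 1) :
    HasDerivAt (fun s ↦ (M s).det) M'.trace t := by
  let f : (ι → ι → ℝ) → ℝ := fun A ↦ (Matrix.of A).det
  have hf : DifferentiableAt ℝ f (fun i j ↦ (1 : Matrix ι ι ℝ) i j) := by
    simp only [f, det_apply, of_apply]
    fun_prop
  have hline : HasDerivAt (fun r : ℝ ↦ f (fun i j ↦ (1 + r • M') i j)) M'.trace 0 := by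
    have := ((hasDerivAt_id (0 : ℝ)).const_mul M'.trace).const_add 1 |>.add
      (((det (1 + (Polynomial.X : Polynomial ℝ) • M'.map Polynomial.C)).divX.divX.hasDerivAt 0).mul
        (hasDerivAt_pow 2 (0 : ℝ)))
    convert! this using 1
    · ext r
      exact det_one_add_smul r M'
    · simp
  have hpi : HasDerivAt (fun s i j ↦ M s i j) (fun i j ↦ M' i j) t :=
    hasDerivAt_pi.2 fun i ↦ hasDerivAt_pi.2 fun j ↦ hM i j
  have hpi' : HasDerivAt (fun (r : ℝ) i j ↦ (1 + r • M') i j) (fun i j ↦ M' i j) 0 :=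
    hasDerivAt_pi.2 fun i ↦ hasDerivAt_pi.2 fun j ↦ by
      simpa using ((hasDerivAt_id (0 : ℝ)).mul_const (M' i j)).const_add ((1 : Matrix ι ι ℝ) i j)
  have e1 := hf.hasFDerivAt.comp_hasDerivAt_of_eq t hpi (by rw [h1])
  have e2 := hf.hasFDerivAt.comp_hasDerivAt_of_eq 0 hpi' (by simp)
  rw [hline.unique e2]
  exact e1

open scoped Norms.Operator in
theorem hasDerivAt_exp_smul_apply (A : Matrix ι ι ℝ) (i j : ι) :
    HasDerivAt (fun t : ℝ ↦ NormedSpace.exp (t • A) i j) (A i j) 0 := by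
  have h := hasDerivAt_exp_smul_const (𝕂 := ℝ) A (0 : ℝ)
  have := (LinearMap.toContinuousLinearMap (entryLinearMap ℝ ℝ i j)).hasFDerivAt.comp_hasDerivAt
    (0 : ℝ) h
  simpa [Function.comp_def] using! this

theorem det_exp_eq_one_of_trace_eq_zero {A : Matrix ι ι ℝ} (hA : A.trace = 0) :
    (NormedSpace.exp A).det = 1 := by
  have hadd (s t : ℝ) : (NormedSpace.exp ((s + t) • A)).det
      = (NormedSpace.exp (s • A)).det * (NormedSpace.exp (t • A)).det := by
    rw [add_smul, exp_add_of_commute _ _ (((Commute.refl A).smul_left s).smul_right t), det_mul]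
  have h0 : HasDerivAt (fun t : ℝ ↦ (NormedSpace.exp (t • A)).det) 0 0 := by
    simpa only [hA] using hasDerivAt_det_of_eq_one (hasDerivAt_exp_smul_apply A)
      (by rw [zero_smul, NormedSpace.exp_zero])
  have hd (t : ℝ) : HasDerivAt (fun t : ℝ ↦ (NormedSpace.exp (t • A)).det) 0 t := by
    have := (HasDerivAt.comp_sub_const t t (by simpa only [sub_self] using h0)).const_mul
      (NormedSpace.exp (t • A)).det
    simpa [← hadd] using this
  have := is_const_of_deriv_eq_zero (fun t ↦ (hd t).differentiableAt) (fun t ↦ (hd t).deriv) 1 0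
  simpa using this

open scoped Norms.Operator in
theorem tsum_one_sub_exp_neg_eq_exp_mul_tsum_sinhc (A : Matrix ι ι ℝ) :
    ∑' j : ℕ, ((-1 : ℝ) ^ j / (Nat.factorial (j + 1))) • A ^ j
      = NormedSpace.exp ((-1 / 2 : ℝ) • A) *
        ∑' j : ℕ, ((1 : ℝ) / (Nat.factorial (2 * j + 1))) • ((1/2 : ℝ) • A) ^ (2 * j) :=
  _root_.tsum_one_sub_exp_neg_eq_exp_mul_tsum_sinhc A

end Matrix

/-- For a traceless real matrix `D`,
`det((1 − e^{−D})/D) = det(sinh(D/2)/(D/2))`, both matrices defined by their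
everywhere-convergent power series. -/
theorem det_one_sub_exp_eq_det_sinhc
    (n : ℕ) (D : Matrix (Fin n) (Fin n) ℝ) (hD : D.trace = 0) :
    (∑' j : ℕ, ((-1 : ℝ) ^ j / (Nat.factorial (j + 1))) • D ^ j).det
      = (∑' j : ℕ, ((1 : ℝ) / (Nat.factorial (2 * j + 1))) • ((1/2 : ℝ) • D) ^ (2 * j)).det := by
  rw [Matrix.tsum_one_sub_exp_neg_eq_exp_mul_tsum_sinhc, det_mul,
    det_exp_eq_one_of_trace_eq_zero (by rw [trace_smul, hD, smul_zero]), one_mul]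
end

section
/- Let N ∈ ℕ and let C^A_{BC} (A,B,C = 1,…,N) be real constants, antisymmetric in the lower indices (C^A_{BC} = −C^A_{CB}), such that the N×N matrices C_A with entries (C_A)^B_C = C^B_{AC} satisfy [C_A, C_B] = Σ_C C^C_{AB} C_C. For k ∈ ℝ^N set C(k) := Σ_A k^A C_A and Y(k) := Σ_{j≥0} (−1)^j C(k)^j/(j+1)!. Then for all k ∈ ℝ^N and all indices A, L, M: ∂Y^A_M/∂k^L (k) − ∂Y^A_L/∂k^M (k) = −Σ_{B,C} C^A_{BC} Y^B_L(k) Y^C_M(k). -/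
open Matrix

/-- Partial derivative `∂/∂k^L` of a real-valued function on `ℝ^N`. -/
noncomputable def partialDeriv' {N : ℕ} (f : (Fin N → ℝ) → ℝ) (L : Fin N) (k : Fin N → ℝ) : ℝ :=
  fderiv ℝ f k (Pi.single L 1)

open Finset.HasAntidiagonal (antidiagonal mem_antidiagonal)

/-- Degree-by-degree form of the Maurer–Cartan equation: `p`, `q` are the homogeneous parts of
`Y u`, `Y v`, and `r`, `s` those of the derivatives `∂_u (Y v)`, `∂_v (Y u)`. -/
theorem sub_eq_neg_sum_antidiagonal_bracket {V : Type*} [AddCommGroup V] [Module ℝ V]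
    (br : V →ₗ[ℝ] V →ₗ[ℝ] V) (k u v : V) (hanti : ∀ x y, br x y = -br y x)
    (hder : ∀ x y, br k (br x y) = br (br k x) y + br x (br k y))
    (p q r s : ℕ → V) (hp0 : p 0 = u) (hq0 : q 0 = v)
    (hp : ∀ n : ℕ, ((n : ℝ) + 2) • p (n + 1) = -br k (p n))
    (hq : ∀ n : ℕ, ((n : ℝ) + 2) • q (n + 1) = -br k (q n))
    (hr0 : r 0 = 0) (hs0 : s 0 = 0)
    (hr : ∀ n : ℕ, ((n : ℝ) + 2) • r (n + 1) = -br u (q n) - br k (r n))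
    (hs : ∀ n : ℕ, ((n : ℝ) + 2) • s (n + 1) = -br v (p n) - br k (s n)) (n : ℕ) :
    r (n + 1) - s (n + 1) = -∑ x ∈ antidiagonal n, br (p x.1) (q x.2) := by
  have key (n : ℕ) : ((n : ℝ) + 3) • ∑ x ∈ antidiagonal (n + 1), br (p x.1) (q x.2)
      = br u (q (n + 1)) + br (p (n + 1)) v
        - br k (∑ x ∈ antidiagonal n, br (p x.1) (q x.2)) := by
    have e : ((n : ℝ) + 3) • ∑ x ∈ antidiagonal (n + 1), br (p x.1) (q x.2)
        = ∑ x ∈ antidiagonal (n + 1), br (((x.1 : ℝ) + 1) • p x.1) (q x.2)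
          + ∑ x ∈ antidiagonal (n + 1), br (p x.1) (((x.2 : ℝ) + 1) • q x.2) := by
      rw [← Finset.sum_add_distrib, Finset.smul_sum]
      refine Finset.sum_congr rfl fun x hx => ?_
      have h : ((x.1 : ℝ) + x.2) = n + 1 := by exact_mod_cast mem_antidiagonal.1 hx
      have h' : (n : ℝ) + 3 = (x.1 + 1) + (x.2 + 1) := by linarith
      rw [h', add_smul, map_smul, map_smul, LinearMap.smul_apply]
    have c (m : ℕ) : (((m + 1 : ℕ) : ℝ) + 1) = m + 2 := by push_cast; ring
    rw [e, Finset.Nat.sum_antidiagonal_succ, Finset.Nat.sum_antidiagonal_succ']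
    simp only [c, hp, hq, hp0, hq0, map_sum, hder, Finset.sum_add_distrib, map_neg,
      LinearMap.neg_apply, Finset.sum_neg_distrib, Nat.cast_zero, zero_add, one_smul]
    abel
  induction n with
  | zero =>
    have h1 := hr 0
    have h2 := hs 0
    simp only [hr0, hs0, hp0, hq0, map_zero, sub_zero, Nat.cast_zero, zero_add] at h1 h2
    have : (2 : ℝ) • (r 1 - s 1) = (2 : ℝ) • (-br u v) := by
      rw [smul_sub, h1, h2, hanti v u, two_smul]; abel
    simpa [hp0, hq0] using smul_right_injective V (two_ne_zero (α := ℝ)) this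
  | succ n ih =>
    have h1 := hr (n + 1)
    have h2 := hs (n + 1)
    have c : (((n + 1 : ℕ) : ℝ) + 2) = n + 3 := by push_cast; ring
    rw [c] at h1 h2
    have h0 : (n : ℝ) + 3 ≠ 0 := by positivity
    refine smul_right_injective V h0 ?_
    have h3 : br k (r (n + 1)) - br k (s (n + 1))
        = - br k (∑ x ∈ antidiagonal n, br (p x.1) (q x.2)) := by
      rw [← map_sub, ih, map_neg]
    simp only [smul_sub, smul_neg]
    rw [h1, h2, key, hanti v, ← sub_eq_zero]
    rw [← sub_eq_zero] at h3
    rw [← neg_eq_zero, ← h3]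
    abel

section
variable {𝔸 : Type*} [NormedRing 𝔸] [NormedAlgebra ℝ 𝔸]

theorem fderiv_pow_succ_apply (n : ℕ) (x h : 𝔸) :
    fderiv ℝ (fun y : 𝔸 => y ^ (n + 1)) x h
      = h * x ^ n + x * fderiv ℝ (fun y : 𝔸 => y ^ n) x h := by
  have : (fun y : 𝔸 => y ^ (n + 1)) = fun y => y * y ^ n := by ext y; exact pow_succ' y n
  have hd : HasFDerivAt (fun y : 𝔸 => y * y ^ n) _ x :=
    (hasFDerivAt_id x).mul' (differentiableAt_pow (𝕜 := ℝ) n (x := x)).hasFDerivAt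
  rw [this, hd.fderiv]
  simp [add_comm]

theorem norm_fderiv_pow_apply_le {R : ℝ} (n : ℕ) {x : 𝔸} (hx : ‖x‖ ≤ R) (hR : 1 ≤ R) (h : 𝔸) :
    ‖fderiv ℝ (fun y : 𝔸 => y ^ n) x h‖ ≤ n * R ^ n * ‖h‖ := by
  have hR0 : 0 ≤ R := by linarith
  have hmul (n : ℕ) : ‖h * x ^ n‖ ≤ R ^ n * ‖h‖ := by
    induction n with
    | zero => simp
    | succ n ih =>
      rw [pow_succ, ← mul_assoc]
      calc _ ≤ ‖h * x ^ n‖ * ‖x‖ := norm_mul_le _ _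
        _ ≤ (R ^ n * ‖h‖) * R := by gcongr
        _ = _ := by ring
  induction n with
  | zero => simp
  | succ n ih =>
    rw [fderiv_pow_succ_apply]
    calc _ ≤ ‖h * x ^ n‖ + ‖x‖ * ‖fderiv ℝ (fun y : 𝔸 => y ^ n) x h‖ :=
          (norm_add_le _ _).trans (by gcongr; exact norm_mul_le _ _)
      _ ≤ R ^ n * ‖h‖ + R * (n * R ^ n * ‖h‖) := by gcongr; exact hmul n
      _ ≤ R ^ (n + 1) * ‖h‖ + R * (n * R ^ n * ‖h‖) := by gcongr; simp
      _ = _ := by push_cast; ring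

/-- The Taylor coefficients of `(1 - exp (-x)) / x`. -/
noncomputable def phiCoeff (j : ℕ) : ℝ := (-1 : ℝ) ^ j / (Nat.factorial (j + 1))

theorem norm_phiCoeff (j : ℕ) : ‖phiCoeff j‖ = 1 / (Nat.factorial (j + 1)) := by
  simp [phiCoeff]

theorem phiCoeff_succ (j : ℕ) : ((j : ℝ) + 2) * phiCoeff (j + 1) = -phiCoeff j := by
  have := Nat.factorial_ne_zero (j + 1)
  rw [phiCoeff, phiCoeff, Nat.factorial_succ (j + 1)]
  push_cast
  have h2 : (j : ℝ) + 2 ≠ 0 := by positivity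
  field_simp
  ring

theorem summable_norm_phiCoeff_smul_pow (x : 𝔸) : Summable fun j => ‖phiCoeff j • x ^ j‖ := by
  refine .of_nonneg_of_le (fun _ => norm_nonneg _) (fun j => ?_)
    (NormedSpace.norm_expSeries_summable' (𝕂 := ℝ) x)
  rw [norm_smul, norm_smul, norm_phiCoeff, norm_inv, ← one_div, Real.norm_natCast]
  gcongr
  omega

theorem norm_phiCoeff_smul_fderiv_pow_le {R : ℝ} (j : ℕ) {x : 𝔸} (hx : ‖x‖ ≤ R) (hR : 1 ≤ R) :
    ‖phiCoeff j • fderiv ℝ (fun y : 𝔸 => y ^ j) x‖ ≤ R ^ j / j.factorial := by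
  have hR0 : 0 ≤ R := by linarith
  have h := ContinuousLinearMap.opNorm_le_bound _ (by positivity)
    (norm_fderiv_pow_apply_le j hx hR)
  rw [norm_smul, norm_phiCoeff, Nat.factorial_succ]
  calc _ ≤ 1 / (((j + 1) * j.factorial : ℕ) : ℝ) * ((j + 1) * R ^ j) := by
        gcongr
        exact h.trans (by gcongr; linarith)
    _ = _ := by push_cast; field_simp

variable [CompleteSpace 𝔸]

theorem summable_phiCoeff_smul_fderiv_pow (x : 𝔸) :
    Summable fun j => phiCoeff j • fderiv ℝ (fun y : 𝔸 => y ^ j) x :=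
  .of_norm_bounded (Real.summable_pow_div_factorial (‖x‖ + 1)) fun j =>
    norm_phiCoeff_smul_fderiv_pow_le j (by linarith) (by linarith [norm_nonneg x])

theorem hasFDerivAt_tsum_phiCoeff_smul_pow (x : 𝔸) :
    HasFDerivAt (fun y : 𝔸 => ∑' j, phiCoeff j • y ^ j)
      (∑' j, phiCoeff j • fderiv ℝ (fun y : 𝔸 => y ^ j) x) x := by
  have hx : x ∈ Metric.ball (0 : 𝔸) (‖x‖ + 1) := by simp
  refine hasFDerivAt_tsum_of_isPreconnected (Real.summable_pow_div_factorial (‖x‖ + 1))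
    Metric.isOpen_ball (convex_ball _ _).isPreconnected
    (fun j y _ => (differentiableAt_pow (𝕜 := ℝ) j (x := y)).hasFDerivAt.const_smul (phiCoeff j))
    (fun j y hy => norm_phiCoeff_smul_fderiv_pow_le j (by simpa using (mem_ball_zero_iff.1 hy).le)
      (by linarith [norm_nonneg x])) hx (summable_norm_phiCoeff_smul_pow x).of_norm hx

theorem exists_hasSum_fderiv_tsum_phiCoeff {E : Type*} [NormedAddCommGroup E] [NormedSpace ℝ E]
    (P : E →L[ℝ] 𝔸) (k u : E) :
    ∃ D : ℕ → 𝔸, D 0 = 0 ∧ (∀ n, D (n + 1) = P u * P k ^ n + P k * D n) ∧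
      ∀ l : 𝔸 →L[ℝ] ℝ, HasSum (fun j => l (phiCoeff j • D j))
        (fderiv ℝ (fun k' => l (∑' j, phiCoeff j • P k' ^ j)) k u) := by
  refine ⟨fun n => fderiv ℝ (fun y : 𝔸 => y ^ n) (P k) (P u), by simp,
    fun n => fderiv_pow_succ_apply n _ _, fun l => ?_⟩
  have h := l.hasFDerivAt.comp k
    ((hasFDerivAt_tsum_phiCoeff_smul_pow (P k)).comp k P.hasFDerivAt)
  have h' : fderiv ℝ (fun k' => l (∑' j, phiCoeff j • P k' ^ j)) k = _ := h.fderiv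
  rw [h']
  have hs := (summable_phiCoeff_smul_fderiv_pow (P k)).hasSum
  exact (hs.mapL (ContinuousLinearMap.apply ℝ 𝔸 (P u))).mapL l

end

theorem hasSum_sum_antidiagonal_bilinear {N : ℕ} (c : Fin N → Fin N → ℝ) {p q : ℕ → Fin N → ℝ}
    (hp : ∀ B, Summable fun j => ‖p j B‖) (hq : ∀ B, Summable fun j => ‖q j B‖) :
    HasSum (fun n => ∑ x ∈ antidiagonal n, ∑ B, ∑ B', c B B' * p x.1 B * q x.2 B')
      (∑ B, ∑ B', c B B' * (∑' j, p j B) * ∑' j, q j B') := by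
  have h : HasSum (fun n => ∑ B, ∑ B', c B B' *
      ∑ x ∈ antidiagonal n, p x.1 B * q x.2 B')
      (∑ B, ∑ B', c B B' * ((∑' j, p j B) * ∑' j, q j B')) := by
    refine hasSum_sum fun B _ => hasSum_sum fun B' _ => HasSum.mul_left _ ?_
    rw [tsum_mul_tsum_eq_tsum_sum_antidiagonal_of_summable_norm (hp B) (hq B')]
    exact (summable_norm_sum_mul_antidiagonal_of_summable_norm (hp B) (hq B')).of_norm.hasSum
  convert h using 1
  · ext n
    rw [Finset.sum_comm]
    refine Finset.sum_congr rfl fun B _ => ?_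
    rw [Finset.sum_comm]
    refine Finset.sum_congr rfl fun B' _ => ?_
    simp only [Finset.mul_sum, mul_assoc]
  · simp only [mul_assoc]

/-- The matrix `Y(k) = (1 − exp(−C(k)))/C(k)` satisfies the Maurer–Cartan
equation `∂_L Y^A_M − ∂_M Y^A_L = −C^A_{BC} Y^B_L Y^C_M`. -/
theorem maurer_cartan_Y
    (N : ℕ)
    (C : Fin N → Fin N → Fin N → ℝ)
    (hCanti : ∀ A B C', C A B C' = -C A C' B)
    (CM : Fin N → Matrix (Fin N) (Fin N) ℝ)
    (hCM : ∀ A B C', CM A B C' = C B A C')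
    (hCC : ∀ A B, CM A * CM B - CM B * CM A = ∑ C', C C' A B • CM C')
    (Y : (Fin N → ℝ) → Matrix (Fin N) (Fin N) ℝ)
    (hY : ∀ k, Y k =
      ∑' j : ℕ, ((-1 : ℝ) ^ j / (Nat.factorial (j + 1))) • (∑ A, k A • CM A) ^ j) :
    ∀ (k : Fin N → ℝ) (A L M : Fin N),
      partialDeriv' (fun k' => Y k' A M) L k - partialDeriv' (fun k' => Y k' A L) M k
        = -∑ B, ∑ C', C A B C' * Y k B L * Y k C' M := by
  intro k A L M
  let _ : NormedRing (Matrix (Fin N) (Fin N) ℝ) := Matrix.linftyOpNormedRing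
  let _ : NormedAlgebra ℝ (Matrix (Fin N) (Fin N) ℝ) := Matrix.linftyOpNormedAlgebra
  let P : (Fin N → ℝ) →L[ℝ] Matrix (Fin N) (Fin N) ℝ :=
    LinearMap.toContinuousLinearMap (Fintype.linearCombination ℝ CM)
  have hP (x : Fin N → ℝ) : P x = ∑ A, x A • CM A := rfl
  let l (i j : Fin N) : Matrix (Fin N) (Fin N) ℝ →L[ℝ] ℝ :=
    LinearMap.toContinuousLinearMap (Matrix.entryLinearMap ℝ ℝ i j)
  have hl (i j : Fin N) (X : Matrix (Fin N) (Fin N) ℝ) : l i j X = X i j := rfl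
  have hYP (x : Fin N → ℝ) : Y x = ∑' j, phiCoeff j • P x ^ j := hY x
  let br : (Fin N → ℝ) →ₗ[ℝ] (Fin N → ℝ) →ₗ[ℝ] (Fin N → ℝ) :=
    (Matrix.toLin' : Matrix (Fin N) (Fin N) ℝ ≃ₗ[ℝ] _).toLinearMap ∘ₗ P.toLinearMap
  have hbr (x y : Fin N → ℝ) : br x y = P x *ᵥ y := rfl
  have hPe (x : Fin N → ℝ) (i j : Fin N) : P x i j = ∑ B, x B * C i B j := by
    simp [hP, Matrix.sum_apply, hCM]
  have hbrA (x y : Fin N → ℝ) (i : Fin N) :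
      br x y i = ∑ B, ∑ B', C i B B' * x B * y B' := by
    simp only [hbr, Matrix.mulVec, dotProduct, hPe, Finset.sum_mul]
    rw [Finset.sum_comm]
    exact Finset.sum_congr rfl fun _ _ => Finset.sum_congr rfl fun _ _ => by ring
  have hanti (x y : Fin N → ℝ) : br x y = -br y x := by
    ext i
    rw [Pi.neg_apply, hbrA, hbrA, Finset.sum_comm, ← Finset.sum_neg_distrib]
    refine Finset.sum_congr rfl fun B _ => ?_
    rw [← Finset.sum_neg_distrib]
    refine Finset.sum_congr rfl fun B' _ => ?_
    rw [hCanti]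
    ring
  have hcomm (x y : Fin N → ℝ) : P x * P y - P y * P x = P (br x y) := by
    have h1 : P x * P y - P y * P x = ∑ A, ∑ B, (x A * y B) • (CM A * CM B - CM B * CM A) := by
      simp only [hP, Finset.sum_mul, Finset.mul_sum, smul_sub, Finset.sum_sub_distrib,
        smul_mul_assoc, mul_smul_comm, Finset.smul_sum, smul_smul]
      congr 1
      · rw [Finset.sum_comm]
        simp only [mul_comm]
    simp only [h1, hCC, hP (br x y), hbrA, Finset.smul_sum, Finset.sum_smul, smul_smul]
    rw [Finset.sum_comm_cycle]
    refine Finset.sum_congr rfl fun _ _ => Finset.sum_congr rfl fun _ _ =>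
      Finset.sum_congr rfl fun _ _ => by congr 1; ring
  have hder (x y : Fin N → ℝ) : br k (br x y) = br (br k x) y + br x (br k y) := by
    simp only [hbr]
    rw [← hbr k x, ← hcomm, Matrix.sub_mulVec, Matrix.mulVec_mulVec, Matrix.mulVec_mulVec]
    abel
  let p (L : Fin N) (n : ℕ) : Fin N → ℝ := (phiCoeff n • P k ^ n) *ᵥ Pi.single L 1
  choose D hD0 hDsucc hDsum using fun L : Fin N =>
    exists_hasSum_fderiv_tsum_phiCoeff P k (Pi.single L 1)
  let r (L M : Fin N) (n : ℕ) : Fin N → ℝ :=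
    (phiCoeff n • D L n) *ᵥ Pi.single M 1
  have hp0 (L : Fin N) : p L 0 = Pi.single L 1 := by
    simp only [p, phiCoeff, pow_zero, zero_add, Nat.factorial_one, Nat.cast_one, div_one, one_smul,
      Matrix.one_mulVec]
  have hr0 (L M : Fin N) : r L M 0 = 0 := by
    simp only [r, hD0, smul_zero, Matrix.zero_mulVec]
  have hp (L : Fin N) (n : ℕ) : ((n : ℝ) + 2) • p L (n + 1) = -br k (p L n) := by
    simp only [p, hbr, Matrix.mulVec_mulVec, ← Matrix.smul_mulVec, ← Matrix.neg_mulVec]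
    rw [smul_smul, phiCoeff_succ, pow_succ', mul_smul_comm, neg_smul]
  have hr (L M : Fin N) (n : ℕ) : ((n : ℝ) + 2) • r L M (n + 1)
      = -br (Pi.single L 1) (p M n) - br k (r L M n) := by
    simp only [r, p, hbr, Matrix.mulVec_mulVec, ← Matrix.smul_mulVec, ← Matrix.neg_mulVec,
      ← Matrix.sub_mulVec]
    rw [smul_smul, phiCoeff_succ, hDsucc, mul_smul_comm, mul_smul_comm, neg_smul,
      smul_add, neg_add']
    rfl
  have hpA (L B : Fin N) (n : ℕ) : p L n B = l B L (phiCoeff n • P k ^ n) := by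
    simp only [p, Matrix.mulVec_single_one]
    rfl
  have hrA (L M : Fin N) (n : ℕ) : r L M n A = l A M (phiCoeff n • D L n) := by
    simp only [r, Matrix.mulVec_single_one]
    rfl
  have hpsum (L B : Fin N) : Summable fun j => ‖p L j B‖ := by
    simp only [hpA]
    refine .of_nonneg_of_le (fun _ => norm_nonneg _) (fun j => (l B L).le_opNorm _)
      ((summable_norm_phiCoeff_smul_pow (P k)).mul_left _)
  have hYA (L B : Fin N) : Y k B L = ∑' j, p L j B := by
    simp only [hpA]
    rw [← (l B L).map_tsum (summable_norm_phiCoeff_smul_pow (P k)).of_norm, hl, hYP]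
  have hrsum (L M : Fin N) :
      HasSum (fun j => r L M j A) (partialDeriv' (fun k' => Y k' A M) L k) := by
    simp only [hrA, partialDeriv', hYP]
    exact hDsum L (l A M)
  have h1 := (hasSum_nat_add_iff' 1).2 ((hrsum L M).sub (hrsum M L))
  have h2 := (hasSum_sum_antidiagonal_bilinear (C A) (hpsum L) (hpsum M)).neg
  simp only [hYA]
  have h3 (n : ℕ) : r L M (n + 1) A - r M L (n + 1) A = -∑ x ∈ antidiagonal n,
      ∑ B, ∑ B', C A B B' * p L x.1 B * p M x.2 B' := by
    have h := congrFun (sub_eq_neg_sum_antidiagonal_bracket br k _ _ hanti hder (p L) (p M) (r L M)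
      (r M L) (hp0 L) (hp0 M) (hp L) (hp M) (hr0 L M) (hr0 M L) (hr L M) (hr M L) n) A
    simpa only [Pi.sub_apply, Pi.neg_apply, Finset.sum_apply, hbrA] using h
  simp only [h3, Finset.sum_range_one, hr0, Pi.zero_apply, sub_zero] at h1
  exact h1.unique h2
end

section
/- Let N ∈ ℕ and let C^A_{BC} (A,B,C = 1,…,N) be real constants, antisymmetric in the lower indices, such that the N×N matrices C_A with entries (C_A)^B_C = C^B_{AC} satisfy [C_A, C_B] = Σ_C C^C_{AB} C_C. Let γ = (γ_{AB}) be a real symmetric invertible N×N matrix satisfying γ_{AB} C^B_{CD} + γ_{DB} C^B_{CA} = 0. For k ∈ ℝ^N set C(k) := Σ_A k^A C_A and Y(k) := Σ_{j≥0} (−1)^j C(k)^j/(j+1)!. Then for every k ∈ ℝ^N: tr C(k) = 0, and the matrix G(k) := Y(k)^T γ Y(k) satisfies det G(k) = det γ · (det(Σ_{j≥0} (C(k)/2)^{2j}/(2j+1)!))², i.e. det G = det γ · (det[sinh(C(k)/2)/(C(k)/2)])². -/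
open Matrix

/-- The analytic matrix function `sinh(X)/X = Σ_{j≥0} X^{2j}/(2j+1)!`. -/
noncomputable def matSinhc {N : ℕ} (X : Matrix (Fin N) (Fin N) ℝ) : Matrix (Fin N) (Fin N) ℝ :=
  ∑' j : ℕ, ((1 : ℝ) / (Nat.factorial (2 * j + 1))) • X ^ (2 * j)

section

open scoped Matrix.Norms.Operator

/-- The coefficients of `exp (-x / 2)` and `sinh (x / 2) / (x / 2)` convolve to those of
`(1 - exp (-x)) / x`. -/
theorem sum_antidiagonal_exp_mul_sinhc (n : ℕ) :
    ∑ p ∈ Finset.HasAntidiagonal.antidiagonal n, ((-1 / 2 : ℝ) ^ p.1 / p.1.factorial) *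
      (((1 / 2 : ℝ) ^ (p.2 + 1) - (-1 / 2 : ℝ) ^ (p.2 + 1)) / (p.2 + 1).factorial) =
      (-1 : ℝ) ^ n / (n + 1).factorial := by
  have hbinom (a b : ℝ) : ∑ p ∈ Finset.HasAntidiagonal.antidiagonal (n + 1),
      a ^ p.1 / p.1.factorial * (b ^ p.2 / p.2.factorial) =
        (a + b) ^ (n + 1) / (n + 1).factorial := by
    rw [(Commute.all a b).add_pow', Finset.sum_div]
    refine Finset.sum_congr rfl fun p hp => ?_
    have hp' := Finset.HasAntidiagonal.mem_antidiagonal.mp hp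
    have hc : (((n + 1).choose p.1 : ℕ) : ℝ) * p.1.factorial * p.2.factorial
        = (n + 1).factorial := by
      rw [← hp', Nat.choose_symm_add]
      exact_mod_cast Nat.add_choose_mul_factorial_mul_factorial p.1 p.2
    rw [nsmul_eq_mul, ← hc]
    have h1 : (p.1.factorial : ℝ) ≠ 0 := by positivity
    have h2 : (p.2.factorial : ℝ) ≠ 0 := by positivity
    have h3 : (((n + 1).choose p.1 : ℕ) : ℝ) ≠ 0 := by
      have : (n + 1).choose p.1 ≠ 0 := (Nat.choose_pos (by omega)).ne'
      exact_mod_cast this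
    field_simp
  have h := congrArg₂ (· - ·) (hbinom (-1 / 2) (1 / 2)) (hbinom (-1 / 2) (-1 / 2))
  simp only [← Finset.sum_sub_distrib, ← mul_sub, ← sub_div] at h
  rw [Finset.Nat.sum_antidiagonal_succ'] at h
  norm_num at h
  rw [pow_succ (-1 : ℝ) n] at h
  norm_num [neg_div, sub_div, mul_sub] at h ⊢
  linarith

theorem Matrix.summable_norm_div_factorial_smul_pow {N : ℕ} (X : Matrix (Fin N) (Fin N) ℝ)
    {c : ℕ → ℝ} {r : ℝ} (hc : ∀ j, |c j| ≤ r ^ j / j.factorial) :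
    Summable fun j : ℕ => ‖c j • X ^ j‖ := by
  refine .of_nonneg_of_le (fun _ => norm_nonneg _) (fun j => ?_)
    ((Real.summable_pow_div_factorial (r * ‖X‖)).mul_left ‖(1 : Matrix (Fin N) (Fin N) ℝ)‖)
  have hX : ‖X ^ j‖ ≤ ‖(1 : Matrix (Fin N) (Fin N) ℝ)‖ * ‖X‖ ^ j := by
    induction j with
    | zero => simp
    | succ j ih =>
      rw [pow_succ, pow_succ, ← mul_assoc]
      exact (norm_mul_le _ _).trans (by gcongr)
  have hr : 0 ≤ r ^ j / j.factorial := (abs_nonneg _).trans (hc j)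
  rw [norm_smul, Real.norm_eq_abs, mul_pow]
  calc |c j| * ‖X ^ j‖ ≤ (r ^ j / j.factorial) * (‖(1 : Matrix (Fin N) (Fin N) ℝ)‖ * ‖X‖ ^ j) := by
        gcongr
        exact hc j
    _ = _ := by ring

theorem matSinhc_half_eq_tsum {N : ℕ} (X : Matrix (Fin N) (Fin N) ℝ) :
    matSinhc ((1 / 2 : ℝ) • X) = ∑' j : ℕ,
      (((1 / 2 : ℝ) ^ (j + 1) - (-1 / 2 : ℝ) ^ (j + 1)) / (j + 1).factorial) • X ^ j := by
  have hinj : Function.Injective fun j : ℕ => 2 * j := fun a b h => by simpa using h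
  rw [matSinhc, ← hinj.tsum_eq (f := fun j : ℕ =>
    (((1 / 2 : ℝ) ^ (j + 1) - (-1 / 2 : ℝ) ^ (j + 1)) / (j + 1).factorial) • X ^ j)]
  · refine tsum_congr fun j => ?_
    rw [smul_pow, smul_smul]
    congr 1
    rw [pow_succ (1 / 2 : ℝ), pow_succ (-1 / 2 : ℝ), neg_div, (even_two_mul j).neg_pow]
    ring
  · intro j hj
    by_contra hne
    have hodd : Odd j := by
      rw [← Nat.not_even_iff_odd, even_iff_exists_two_mul]
      rintro ⟨i, rfl⟩
      exact hne ⟨i, rfl⟩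
    apply hj
    simp [neg_div, hodd.add_one.neg_pow]

/-- `(1 - exp (-X)) / X = exp (-X / 2) * (sinh (X / 2) / (X / 2))` for matrices. -/
theorem tsum_neg_one_pow_smul_pow_eq_exp_mul_matSinhc {N : ℕ} (X : Matrix (Fin N) (Fin N) ℝ) :
    ∑' j : ℕ, ((-1 : ℝ) ^ j / (Nat.factorial (j + 1))) • X ^ j =
      NormedSpace.exp ((-1 / 2 : ℝ) • X) * matSinhc ((1 / 2 : ℝ) • X) := by
  have hexp : NormedSpace.exp ((-1 / 2 : ℝ) • X) =
      ∑' j : ℕ, ((-1 / 2 : ℝ) ^ j / j.factorial) • X ^ j := by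
    rw [NormedSpace.exp_eq_tsum ℝ]
    refine tsum_congr fun j => ?_
    rw [smul_pow, smul_smul, inv_mul_eq_div]
  rw [hexp, matSinhc_half_eq_tsum]
  refine Eq.trans ?_ (tsum_mul_tsum_eq_tsum_sum_antidiagonal_of_summable_norm
      (X.summable_norm_div_factorial_smul_pow (r := 1) fun j => ?_)
      (X.summable_norm_div_factorial_smul_pow (r := 1) fun j => ?_)).symm
  · refine tsum_congr fun n => ?_
    rw [← sum_antidiagonal_exp_mul_sinhc, Finset.sum_smul]
    refine Finset.sum_congr rfl fun p hp => ?_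
    rw [smul_mul_smul_comm, ← pow_add, Finset.HasAntidiagonal.mem_antidiagonal.mp hp]
  · rw [abs_div, abs_pow, Nat.abs_cast]
    gcongr
    norm_num [abs_le]
  · rw [abs_div, Nat.abs_cast]
    gcongr
    · refine (abs_sub _ _).trans ?_
      have h : (1 / 2 : ℝ) ^ j ≤ 1 := pow_le_one₀ (by norm_num) (by norm_num)
      rw [abs_pow, abs_pow, one_pow, pow_succ, pow_succ, neg_div, abs_neg,
        abs_of_pos (by norm_num : (0 : ℝ) < 1 / 2)]
      linarith
    · omega

theorem Matrix.trace_eq_zero_of_transpose_mul_eq_neg {n : Type*} [Fintype n] [DecidableEq n]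
    {γ X : Matrix n n ℝ} (hγ : IsUnit γ) (h : Xᵀ * γ = -(γ * X)) : X.trace = 0 := by
  have hdet := (Matrix.isUnit_iff_isUnit_det γ).mp hγ
  have hX : Xᵀ = -(γ * X * γ⁻¹) := by
    rw [← neg_mul, ← h, Matrix.mul_nonsing_inv_cancel_right _ _ hdet]
  have ht := congrArg Matrix.trace hX
  rw [trace_transpose, trace_neg, trace_mul_comm, Matrix.nonsing_inv_mul_cancel_left _ _ hdet] at ht
  linarith

theorem Matrix.exp_transpose_mul_mul_exp {n : Type*} [Fintype n] [DecidableEq n]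
    {γ X : Matrix n n ℝ} (hγ : IsUnit γ) (h : Xᵀ * γ = -(γ * X)) :
    (NormedSpace.exp X)ᵀ * γ * NormedSpace.exp X = γ := by
  have hdet := (Matrix.isUnit_iff_isUnit_det γ).mp hγ
  have hX : Xᵀ = γ * (-X) * γ⁻¹ := by
    rw [mul_neg, ← h, Matrix.mul_nonsing_inv_cancel_right _ _ hdet]
  rw [← Matrix.exp_transpose, hX, Matrix.exp_conj γ (-X) hγ,
    Matrix.nonsing_inv_mul_cancel_right _ _ hdet, mul_assoc, Matrix.exp_neg,
    Matrix.nonsing_inv_mul _ ((Matrix.isUnit_iff_isUnit_det _).mp (Matrix.isUnit_exp X)), mul_one]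

end

/-- `tr C(k) = 0`, and the bi-invariant metric `G(k) = Y(k)ᵀ γ Y(k)` has
determinant `det G = det γ · (det[sinh(C(k)/2)/(C(k)/2)])²`. -/
theorem volume_element_on_group
    (N : ℕ)
    (C : Fin N → Fin N → Fin N → ℝ)
    (hCanti : ∀ A B C', C A B C' = -C A C' B)
    (CM : Fin N → Matrix (Fin N) (Fin N) ℝ)
    (hCM : ∀ A B C', CM A B C' = C B A C')
    (hCC : ∀ A B, CM A * CM B - CM B * CM A = ∑ C', C C' A B • CM C')
    (γ : Matrix (Fin N) (Fin N) ℝ)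
    (hγsymm : γᵀ = γ) (hγinv : IsUnit γ)
    (hγC : ∀ A C' D', ∑ B, (γ A B * C B C' D' + γ D' B * C B C' A) = 0)
    (Ck : (Fin N → ℝ) → Matrix (Fin N) (Fin N) ℝ)
    (hCk : ∀ k, Ck k = ∑ A, k A • CM A)
    (Y : (Fin N → ℝ) → Matrix (Fin N) (Fin N) ℝ)
    (hY : ∀ k, Y k =
      ∑' j : ℕ, ((-1 : ℝ) ^ j / (Nat.factorial (j + 1))) • (Ck k) ^ j) :
    ∀ k : Fin N → ℝ,
      (Ck k).trace = 0 ∧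
      ((Y k)ᵀ * γ * Y k).det = γ.det * (matSinhc ((1/2 : ℝ) • Ck k)).det ^ 2 := by
  intro k
  have hγCM (A : Fin N) : (CM A)ᵀ * γ = -(γ * CM A) := by
    ext i j
    have h := hγC i A j
    rw [Finset.sum_add_distrib] at h
    simp only [Matrix.mul_apply, Matrix.transpose_apply, Matrix.neg_apply, hCM]
    have hs : ∑ x, C x A i * γ x j = ∑ B, γ j B * C B A i :=
      Finset.sum_congr rfl fun x _ => by
        rw [mul_comm, ← Matrix.transpose_apply γ, hγsymm]
    rw [hs]
    linarith
  have hk : (Ck k)ᵀ * γ = -(γ * Ck k) := by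
    rw [hCk, Matrix.transpose_sum, Finset.sum_mul, Finset.mul_sum, ← Finset.sum_neg_distrib]
    refine Finset.sum_congr rfl fun A _ => ?_
    rw [Matrix.transpose_smul, smul_mul_assoc, hγCM, mul_smul_comm, smul_neg]
  refine ⟨Matrix.trace_eq_zero_of_transpose_mul_eq_neg hγinv hk, ?_⟩
  have hE := Matrix.exp_transpose_mul_mul_exp (X := (-1 / 2 : ℝ) • Ck k) hγinv (by
    rw [Matrix.transpose_smul, smul_mul_assoc, hk, mul_smul_comm, smul_neg])
  have hYk : Y k = NormedSpace.exp ((-1 / 2 : ℝ) • Ck k) * matSinhc ((1 / 2 : ℝ) • Ck k) :=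
    (hY k).trans (tsum_neg_one_pow_smul_pow_eq_exp_mul_matSinhc _)
  have hdet := congrArg Matrix.det hE
  simp only [Matrix.det_mul, Matrix.det_transpose] at hdet
  rw [hYk]
  simp only [Matrix.det_mul, Matrix.det_transpose]
  linear_combination (matSinhc ((1 / 2 : ℝ) • Ck k)).det ^ 2 * hdet
end
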